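/- Let n ≥ 1, let a, b be points of the n-dimensional Euclidean space, let c_min = ‖b − a‖₂, and let c > c_min. Then the Lebesgue measure of the set {x : ‖x − a‖₂ + ‖b − x‖₂ < c} equals c·(c² − c_min²)^{(n−1)/2}·ζ_n / 2ⁿ, where ζ_n is the Lebesgue measure of the n-dimensional unit ball. -/

import Mathlib

open MeasureTheory

/-- The triangle-type description of an ellipsoid with foci `±f`, rewritten quadratically. -/
lemma norm_add_add_norm_sub_lt_iff {E : Type*} [NormedAddCommGroup E] [InnerProductSpace ℝ E]
    {f y : E} {r : ℝ} (hr : ‖f‖ < r) :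
    ‖y + f‖ + ‖y - f‖ < 2 * r ↔
      r ^ 2 * ‖y‖ ^ 2 - inner ℝ y f ^ 2 < r ^ 2 * (r ^ 2 - ‖f‖ ^ 2) := by
  have hA := norm_add_sq_real y f
  have hB := norm_sub_sq_real y f
  have hq : inner ℝ y f ^ 2 ≤ ‖y‖ ^ 2 * ‖f‖ ^ 2 := by
    rw [← mul_pow]
    exact sq_le_sq.2 ((abs_real_inner_le_norm y f).trans (le_abs_self _))
  have hA0 := norm_nonneg (y + f)
  have hB0 := norm_nonneg (y - f)
  have hs0 := norm_nonneg f
  have hr0 : 0 < r := hs0.trans_lt hr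
  generalize ‖y + f‖ = A at *
  generalize ‖y - f‖ = B at *
  generalize ‖f‖ = s at *
  generalize inner ℝ y f = q at *
  generalize ‖y‖ ^ 2 = Y at *
  have hsr : 0 < r ^ 2 - s ^ 2 := by nlinarith
  have hprod : (A * B) ^ 2 = (Y + s ^ 2) ^ 2 - 4 * q ^ 2 := by
    rw [mul_pow, hA, hB]; ring
  have hAB0 : 0 ≤ A * B := mul_nonneg hA0 hB0
  constructor
  · intro h
    have h1 : (A + B) ^ 2 < (2 * r) ^ 2 := pow_lt_pow_left₀ h (by positivity) two_ne_zero
    have h2 : A * B < 2 * r ^ 2 - (Y + s ^ 2) := by nlinarith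
    have h3 := pow_lt_pow_left₀ h2 hAB0 two_ne_zero
    nlinarith
  · intro h
    have hY : Y < r ^ 2 := by
      by_contra! hcon
      nlinarith [mul_le_mul_of_nonneg_right hcon hsr.le]
    have h2 : A * B < 2 * r ^ 2 - (Y + s ^ 2) :=
      lt_of_pow_lt_pow_left₀ 2 (by linarith) (by nlinarith)
    exact lt_of_pow_lt_pow_left₀ 2 (by positivity) (by nlinarith)

/-- The linear map stretching by `r` along the unit vector `e` and by `β` orthogonally to it. -/
noncomputable def axialStretch {E : Type*} [NormedAddCommGroup E] [InnerProductSpace ℝ E]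
    (β r : ℝ) (e : E) : E →ₗ[ℝ] E :=
  β • LinearMap.transvection (innerₛₗ ℝ e) ((r / β - 1) • e)

section axialStretch

variable {E : Type*} [NormedAddCommGroup E] [InnerProductSpace ℝ E] {β r : ℝ} {e : E}

lemma axialStretch_apply (hβ : β ≠ 0) (z : E) :
    axialStretch β r e z = β • z + ((r - β) * inner ℝ e z) • e := by
  simp only [axialStretch, LinearMap.smul_apply, LinearMap.transvection.apply, smul_add, smul_smul,
    innerₛₗ_apply_apply]
  congr 2
  field_simp

lemma det_axialStretch [FiniteDimensional ℝ E] (hβ : β ≠ 0) (he : ‖e‖ = 1)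
    (hE : 1 ≤ Module.finrank ℝ E) :
    LinearMap.det (axialStretch β r e) = r * β ^ (Module.finrank ℝ E - 1) := by
  obtain ⟨k, hk⟩ := Nat.exists_eq_add_of_le' hE
  rw [axialStretch, LinearMap.det_smul, LinearMap.transvection.det, hk]
  simp only [map_smul, innerₛₗ_apply_apply, real_inner_self_eq_norm_sq, he, smul_eq_mul,
    Nat.add_sub_cancel]
  field_simp
  ring

lemma norm_axialStretch_sq (hβ : β ≠ 0) (he : ‖e‖ = 1) (z : E) :
    ‖axialStretch β r e z‖ ^ 2 = β ^ 2 * ‖z‖ ^ 2 + (r ^ 2 - β ^ 2) * inner ℝ e z ^ 2 := by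
  rw [axialStretch_apply hβ, norm_add_sq_real, norm_smul, norm_smul, mul_pow, mul_pow, he,
    real_inner_smul_left, real_inner_smul_right, real_inner_comm, Real.norm_eq_abs,
    Real.norm_eq_abs, sq_abs, sq_abs]
  ring

lemma inner_axialStretch (hβ : β ≠ 0) (he : ‖e‖ = 1) (z : E) :
    inner ℝ (axialStretch β r e z) e = r * inner ℝ e z := by
  rw [axialStretch_apply hβ, inner_add_left, real_inner_smul_left, real_inner_smul_left,
    real_inner_self_eq_norm_sq, he, real_inner_comm]
  ring

end axialStretch

lemma axialStretch_preimage_ellipsoid {E : Type*} [NormedAddCommGroup E] [InnerProductSpace ℝ E]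
    {r s : ℝ} {e : E} (he : ‖e‖ = 1) (hs : 0 ≤ s) (hr : s < r) :
    axialStretch √(r ^ 2 - s ^ 2) r e ⁻¹' {y | ‖y + s • e‖ + ‖y - s • e‖ < 2 * r} =
      Metric.ball 0 1 := by
  have hd : 0 < r ^ 2 - s ^ 2 := by nlinarith
  have hβ : √(r ^ 2 - s ^ 2) ≠ 0 := (Real.sqrt_pos.2 hd).ne'
  have hse : ‖s • e‖ = s := by rw [norm_smul, he, mul_one, Real.norm_of_nonneg hs]
  have hr0 : 0 < r := hs.trans_lt hr
  ext z
  rw [Set.mem_preimage, Set.mem_ofPred_eq, norm_add_add_norm_sub_lt_iff (by rwa [hse]), hse,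
    real_inner_smul_right, norm_axialStretch_sq hβ he, inner_axialStretch hβ he,
    Real.sq_sqrt hd.le, mem_ball_zero_iff, ← sq_lt_one_iff₀ (norm_nonneg z)]
  have hpos : 0 < r ^ 2 * (r ^ 2 - s ^ 2) := by positivity
  rw [← mul_lt_mul_iff_right₀ (c := 1) hpos, mul_one]
  ring_nf

/-- Volume of an ellipsoid of revolution centred at the origin. -/
lemma addHaar_ellipsoid {E : Type*} [NormedAddCommGroup E] [InnerProductSpace ℝ E]
    [FiniteDimensional ℝ E] [MeasurableSpace E] [BorelSpace E] (μ : Measure E)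
    [μ.IsAddHaarMeasure] (hE : 1 ≤ Module.finrank ℝ E) {r s : ℝ} {e : E}
    (he : ‖e‖ = 1) (hs : 0 ≤ s) (hr : s < r) :
    μ {y | ‖y + s • e‖ + ‖y - s • e‖ < 2 * r} =
      ENNReal.ofReal (r * √(r ^ 2 - s ^ 2) ^ (Module.finrank ℝ E - 1)) *
        μ (Metric.ball 0 1) := by
  have hβ : 0 < √(r ^ 2 - s ^ 2) := Real.sqrt_pos.2 (by nlinarith)
  have hdet := det_axialStretch (r := r) hβ.ne' he hE
  have hpos : 0 < r * √(r ^ 2 - s ^ 2) ^ (Module.finrank ℝ E - 1) :=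
    mul_pos (hs.trans_lt hr) (pow_pos hβ _)
  rw [← axialStretch_preimage_ellipsoid he hs hr,
    Measure.addHaar_preimage_linearMap μ (hdet ▸ hpos.ne'), hdet, ← mul_assoc,
    abs_of_pos (inv_pos.2 hpos), ← ENNReal.ofReal_mul hpos.le, mul_inv_cancel₀ hpos.ne',
    ENNReal.ofReal_one, one_mul]

lemma exists_norm_eq_one_and_norm_smul_eq {E : Type*} [NormedAddCommGroup E] [NormedSpace ℝ E]
    [Nontrivial E] (v : E) : ∃ e : E, ‖e‖ = 1 ∧ ‖v‖ • e = v := by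
  rcases eq_or_ne v 0 with rfl | hv
  · obtain ⟨e, he⟩ := exists_norm_eq E zero_le_one
    exact ⟨e, he, by simp⟩
  · exact ⟨‖v‖⁻¹ • v, norm_smul_inv_norm hv, smul_inv_smul₀ (norm_ne_zero_iff.2 hv) v⟩

/-- the Lebesgue measure of the `L2`-informed set (hyper-ellipsoid)
`{x : ‖x − a‖ + ‖b − x‖ < c}` equals `c (c² − c_min²)^{(n−1)/2} ζ_n / 2ⁿ`,
where `c_min = ‖b − a‖` and `ζ_n` is the measure of the unit ball in `ℝⁿ`. -/
theorem stmt3 {n : ℕ} (hn : 1 ≤ n) (a b : EuclideanSpace ℝ (Fin n))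
    (c : ℝ) (hc : ‖b - a‖ < c) :
    volume {x : EuclideanSpace ℝ (Fin n) | ‖x - a‖ + ‖b - x‖ < c} =
      ENNReal.ofReal (c * (c ^ 2 - ‖b - a‖ ^ 2) ^ (((n : ℝ) - 1) / 2) / 2 ^ n) *
        volume (Metric.ball (0 : EuclideanSpace ℝ (Fin n)) 1) := by
  have : Nonempty (Fin n) := ⟨⟨0, hn⟩⟩
  obtain ⟨e, he, hea⟩ := exists_norm_eq_one_and_norm_smul_eq (b - a)
  have hd : 0 < c ^ 2 - ‖b - a‖ ^ 2 := by nlinarith [norm_nonneg (b - a)]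
  have hhalf : (‖b - a‖ / 2) • e = (1 / 2 : ℝ) • (b - a) := by
    conv_rhs => rw [← hea]
    rw [smul_smul]
    ring_nf
  have hset : (fun y => y + (1 / 2 : ℝ) • (a + b)) ⁻¹' {x | ‖x - a‖ + ‖b - x‖ < c} =
      {y | ‖y + (‖b - a‖ / 2) • e‖ + ‖y - (‖b - a‖ / 2) • e‖ < 2 * (c / 2)} := by
    ext y
    rw [Set.mem_preimage, Set.mem_ofPred_eq, Set.mem_ofPred_eq, hhalf, norm_sub_rev b,
      mul_div_cancel₀ c two_ne_zero]
    have h₁ : y + (1 / 2 : ℝ) • (a + b) - a = y + (1 / 2 : ℝ) • (b - a) := by module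
    have h₂ : y + (1 / 2 : ℝ) • (a + b) - b = y - (1 / 2 : ℝ) • (b - a) := by module
    rw [h₁, h₂]
  rw [← measure_preimage_add_right volume ((1 / 2 : ℝ) • (a + b)), hset,
    addHaar_ellipsoid volume (by simpa using hn) he (by positivity) (by linarith),
    finrank_euclideanSpace_fin]
  congr 2
  obtain ⟨k, rfl⟩ := Nat.exists_eq_add_of_le' hn
  have hsqrt : √((c / 2) ^ 2 - (‖b - a‖ / 2) ^ 2) = √(c ^ 2 - ‖b - a‖ ^ 2) / 2 := by
    rw [← Real.sqrt_sq (zero_le_two (α := ℝ)), ← Real.sqrt_div hd.le,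
      Real.sqrt_sq (zero_le_two (α := ℝ))]
    ring_nf
  have hpow : (c ^ 2 - ‖b - a‖ ^ 2) ^ ((((k + 1 : ℕ) : ℝ) - 1) / 2) =
      √(c ^ 2 - ‖b - a‖ ^ 2) ^ k := by
    rw [Real.sqrt_eq_rpow, ← Real.rpow_mul_natCast hd.le]
    push_cast
    ring_nf
  rw [hsqrt, hpow, Nat.add_sub_cancel, div_pow, pow_succ]
  field_simp
  ring
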